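/- Let T > 0, let K : (0,T] → [0,∞) be measurable and integrable, and let g : [0,T] → [0,∞) be bounded and measurable such that g(t) ≤ ∫_0^t K(t−s) g(s) ds for every t ∈ [0,T]. Then g(t) = 0 for all t ∈ [0,T]. -/

import Mathlib

open MeasureTheory

/-- The Laplace transform of an integrable function on `(0,T]` is at most `1 / 2` at some
natural number. -/
theorem exists_setIntegral_exp_neg_mul_le_half {T : ℝ} {K : ℝ → ℝ}
    (hK : IntegrableOn K (Set.Ioc 0 T)) :
    ∃ n : ℕ, ∫ u in Set.Ioc 0 T, Real.exp (-(n * u)) * K u ≤ 1 / 2 := by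
  have h : Filter.Tendsto (fun n : ℕ => ∫ u in Set.Ioc 0 T, Real.exp (-(n * u)) * K u)
      Filter.atTop (nhds (∫ _ in Set.Ioc 0 T, (0 : ℝ))) := by
    refine tendsto_integral_of_dominated_convergence (fun u => ‖K u‖) (fun n => ?_) hK.norm
      (fun n => ?_) ?_
    · exact (by fun_prop : Continuous fun u : ℝ => Real.exp (-(n * u))).aestronglyMeasurable.mul
        hK.aestronglyMeasurable
    · filter_upwards [ae_restrict_mem measurableSet_Ioc] with u hu
      rw [norm_mul, Real.norm_of_nonneg (Real.exp_pos _).le]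
      refine mul_le_of_le_one_left (norm_nonneg _) (Real.exp_le_one_iff.2 ?_)
      have := hu.1
      rw [neg_nonpos]
      positivity
    · filter_upwards [ae_restrict_mem measurableSet_Ioc] with u hu
      have h0 : Filter.Tendsto (fun n : ℕ => Real.exp (-(n * u))) Filter.atTop (nhds 0) :=
        Real.tendsto_exp_neg_atTop_nhds_zero.comp
          (tendsto_natCast_atTop_atTop.atTop_mul_const hu.1)
      simpa using h0.mul_const (K u)
  rw [integral_zero] at h
  exact (h.eventually_le_const (by norm_num)).exists

/-- An exponential bound on a subsolution of the convolution inequality improves by a factor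
of two when the Laplace transform of the kernel is at most `1 / 2`. -/
theorem le_half_mul_exp_of_le_convolution {T l C : ℝ} {K g : ℝ → ℝ} (hC : 0 ≤ C) (hl : 0 ≤ l)
    (hKnonneg : ∀ s ∈ Set.Ioc (0 : ℝ) T, 0 ≤ K s)
    (hKint : IntegrableOn K (Set.Ioc 0 T))
    (hK : ∫ u in Set.Ioc 0 T, Real.exp (-(l * u)) * K u ≤ 1 / 2)
    (hgnonneg : ∀ t ∈ Set.Icc (0 : ℝ) T, 0 ≤ g t)
    (hineq : ∀ t ∈ Set.Icc (0 : ℝ) T, g t ≤ ∫ s in (0 : ℝ)..t, K (t - s) * g s)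
    (hg : ∀ t ∈ Set.Icc (0 : ℝ) T, g t ≤ C * Real.exp (l * t)) :
    ∀ t ∈ Set.Icc (0 : ℝ) T, g t ≤ C / 2 * Real.exp (l * t) := by
  intro t ht
  have hsub : Set.Ioc 0 t ⊆ Set.Ioc 0 T := Set.Ioc_subset_Ioc_right ht.2
  have hint : IntegrableOn (fun u => Real.exp (-(l * u)) * K u) (Set.Ioc 0 T) := by
    refine hKint.bdd_mul (c := 1)
      (by fun_prop : Continuous fun u : ℝ => Real.exp (-(l * u))).aestronglyMeasurable ?_
    filter_upwards [ae_restrict_mem measurableSet_Ioc] with u hu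
    rw [Real.norm_of_nonneg (Real.exp_pos _).le, Real.exp_le_one_iff, neg_nonpos]
    exact mul_nonneg hl hu.1.le
  have hrefl : ∫ s in (0 : ℝ)..t, K (t - s) * g s = ∫ u in Set.Ioc 0 t, K u * g (t - u) := by
    have := intervalIntegral.integral_comp_sub_left (a := 0) (b := t)
      (fun u => K u * g (t - u)) t
    simp only [sub_sub_cancel, sub_self, sub_zero] at this
    rw [this, intervalIntegral.integral_of_le ht.1]
  have hmem : ∀ u ∈ Set.Ioc 0 t, t - u ∈ Set.Icc 0 T := fun u hu =>
    ⟨sub_nonneg.2 hu.2, by linarith [hu.1, ht.2]⟩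
  calc g t ≤ ∫ u in Set.Ioc 0 t, K u * g (t - u) := hrefl ▸ hineq t ht
    _ ≤ ∫ u in Set.Ioc 0 t, C * Real.exp (l * t) * (Real.exp (-(l * u)) * K u) := by
        refine integral_mono_of_nonneg ?_ ((hint.mono_set hsub).const_mul _) ?_
        · filter_upwards [ae_restrict_mem measurableSet_Ioc] with u hu
          exact mul_nonneg (hKnonneg u (hsub hu)) (hgnonneg _ (hmem u hu))
        · filter_upwards [ae_restrict_mem measurableSet_Ioc] with u hu
          refine (mul_le_mul_of_nonneg_left (hg _ (hmem u hu)) (hKnonneg u (hsub hu))).trans_eq ?_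
          rw [mul_sub, sub_eq_add_neg, Real.exp_add]
          ring
    _ = C * Real.exp (l * t) * ∫ u in Set.Ioc 0 t, Real.exp (-(l * u)) * K u :=
        integral_const_mul _ _
    _ ≤ C * Real.exp (l * t) * (1 / 2) := by
        refine mul_le_mul_of_nonneg_left (le_trans ?_ hK) (by positivity)
        refine setIntegral_mono_set hint ?_ hsub.eventuallyLE
        filter_upwards [ae_restrict_mem measurableSet_Ioc] with u hu
        exact mul_nonneg (Real.exp_pos _).le (hKnonneg u hu)
    _ = C / 2 * Real.exp (l * t) := by ring

/-- Let `T > 0`, let `K : (0,T] → [0,∞)` be measurable and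
integrable, and let `g : [0,T] → [0,∞)` be bounded and measurable such that
`g t ≤ ∫_0^t K (t−s) g s ds` for every `t ∈ [0,T]`.  Then `g t = 0` for all
`t ∈ [0,T]`. -/
theorem stmt5 (T : ℝ) (hT : 0 < T) (K : ℝ → ℝ) (hKmeas : Measurable K)
    (hKnonneg : ∀ s ∈ Set.Ioc (0 : ℝ) T, 0 ≤ K s)
    (hKint : IntegrableOn K (Set.Ioc 0 T))
    (g : ℝ → ℝ) (hgmeas : Measurable g)
    (hgnonneg : ∀ t ∈ Set.Icc (0 : ℝ) T, 0 ≤ g t)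
    (hgbdd : ∃ M : ℝ, ∀ t ∈ Set.Icc (0 : ℝ) T, g t ≤ M)
    (hineq : ∀ t ∈ Set.Icc (0 : ℝ) T, g t ≤ ∫ s in (0 : ℝ)..t, K (t - s) * g s) :
    ∀ t ∈ Set.Icc (0 : ℝ) T, g t = 0 := by
  obtain ⟨n, hn⟩ := exists_setIntegral_exp_neg_mul_le_half hKint
  obtain ⟨M, hM⟩ := hgbdd
  have hM0 : 0 ≤ M :=
    (hgnonneg 0 (Set.left_mem_Icc.2 hT.le)).trans (hM 0 (Set.left_mem_Icc.2 hT.le))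
  have hbound : ∀ k : ℕ, ∀ t ∈ Set.Icc (0 : ℝ) T, g t ≤ M / 2 ^ k * Real.exp (n * t) := by
    intro k
    induction k with
    | zero =>
      intro t ht
      rw [pow_zero, div_one]
      refine (hM t ht).trans (le_mul_of_one_le_right hM0 (Real.one_le_exp ?_))
      exact mul_nonneg n.cast_nonneg ht.1
    | succ k ih =>
      rw [pow_succ, ← div_div]
      exact le_half_mul_exp_of_le_convolution (by positivity) n.cast_nonneg hKnonneg hKint hn
        hgnonneg hineq ih
  intro t ht
  have hlim : Filter.Tendsto (fun k : ℕ => M / 2 ^ k) Filter.atTop (nhds 0) :=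
    (tendsto_pow_atTop_atTop_of_one_lt one_lt_two).const_div_atTop M
  have hlim' := hlim.mul_const (Real.exp (n * t))
  rw [zero_mul] at hlim'
  exact le_antisymm (ge_of_tendsto' hlim' fun k => hbound k t ht) (hgnonneg t ht)
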